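/- arXiv:1608.04058 — 6 statements merged into one kernel-verified Lean document; each statement's English description precedes it below -/
import Mathlib

section
/- Let β₀, β₁ : Y± → ℕ be finitely supported functions satisfying the rank equation ∑_λ β₀(λ) = ∑_λ β₁(λ) and the antichain inequality ∑_{λ∈I°} β₀(λ) ≥ ∑_{λ∈I} β₁(λ) for every order ideal I ⊆ Y±. Then there exists a finitely supported function c : Y± × Y± → ℕ with c(λ,μ) = 0 unless λ < μ, such that β₀(λ) = ∑_μ c(λ,μ) and β₁(μ) = ∑_λ c(λ,μ) for all λ, μ ∈ Y±; equivalently, the rank Betti table (β₀, β₁) is a nonnegative integer linear combination of pure tables P(λ,μ) over pairs λ < μ. -/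
/-- The extended Young's lattice `Y±`: weakly decreasing integer sequences of
length `k`, i.e. antitone functions `Fin k → ℤ`, ordered pointwise. -/
abbrev YL (k : ℕ) : Type := {f : Fin k → ℤ // Antitone f}

/-- An order ideal: a downward-closed subset of `Y±`. -/
def IsOrderIdeal {k : ℕ} (I : Set (YL k)) : Prop :=
  ∀ ⦃x⦄, x ∈ I → ∀ ⦃y⦄, y ≤ x → y ∈ I

/-- The interior `I° = {λ : λ < μ for some μ ∈ I}` of a subset of `Y±`. -/
def idealInterior {k : ℕ} (I : Set (YL k)) : Set (YL k) :=
  {x | ∃ y ∈ I, x < y}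

/-- The sum of a finitely supported function over a subset of `Y±`. -/
noncomputable def sumOn {k : ℕ} {M : Type*} [AddCommMonoid M]
    (β : YL k →₀ M) (S : Set (YL k)) : M :=
  ∑ x ∈ β.support, Set.indicator S (⇑β) x

/-- The total sum `∑_λ β(λ)` of a finitely supported function on `Y±`. -/
def total {k : ℕ} {M : Type*} [AddCommMonoid M] (β : YL k →₀ M) : M :=
  ∑ x ∈ β.support, β x

/-- The multiset of points recorded by a finitely supported `β : σ →₀ ℕ`, as a finite type:
each `x` appears `β x` times. -/
abbrev Copies {σ : Type*} (β : σ →₀ ℕ) : Type _ := Σ x : β.support, Fin (β x)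

lemma sum_copies {σ : Type*} (β : σ →₀ ℕ) (g : σ → ℕ) :
    ∑ a : Copies β, g a.1 = ∑ x ∈ β.support, β x * g x := by
  rw [Fintype.sum_sigma, ← Finset.sum_coe_sort β.support]
  simp

lemma sum_copies_ite_eq {σ : Type*} [DecidableEq σ] (β : σ →₀ ℕ) (y : σ) :
    ∑ a : Copies β, (if (a.1 : σ) = y then 1 else 0) = β y := by
  rw [sum_copies β (fun x => if x = y then 1 else 0)]
  simp [eq_comm]

lemma sumOn_eq_card {k : ℕ} (β : YL k →₀ ℕ) (S : Set (YL k)) [DecidablePred (· ∈ S)] :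
    sumOn β S = (Finset.univ.filter fun a : Copies β => (a.1 : YL k) ∈ S).card := by
  rw [Finset.card_filter, sum_copies β (fun x => if x ∈ S then 1 else 0)]
  simp [sumOn, Set.indicator_apply]

lemma total_eq_card {k : ℕ} (β : YL k →₀ ℕ) : total β = Fintype.card (Copies β) := by
  rw [← Finset.card_univ, Finset.card_eq_sum_ones, sum_copies β (fun _ => 1)]
  simp [total]

/-- Hall's theorem: the antichain inequalities give an injective choice of a strictly smaller
`β₀`-point for every `β₁`-point. -/
lemma exists_injective_lt {k : ℕ} (β₀ β₁ : YL k →₀ ℕ)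
    (hac : ∀ I : Set (YL k), IsOrderIdeal I → sumOn β₁ I ≤ sumOn β₀ (idealInterior I)) :
    ∃ f : Copies β₁ → Copies β₀, Function.Injective f ∧
      ∀ i, ((f i).1 : YL k) < (i.1 : YL k) := by
  classical
  suffices h : ∀ s : Finset (Copies β₁), s.card ≤ (s.biUnion fun i => Finset.univ.filter
      fun a : Copies β₀ => (a.1 : YL k) < (i.1 : YL k)).card by
    obtain ⟨f, hf, hlt⟩ := (Finset.all_card_le_biUnion_card_iff_exists_injective _).1 h
    exact ⟨f, hf, fun i => (Finset.mem_filter.1 (hlt i)).2⟩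
  intro s
  let I : Set (YL k) := {y | ∃ i ∈ s, y ≤ (i.1 : YL k)}
  have hI : IsOrderIdeal I := fun x ⟨i, hi, hx⟩ y hy => ⟨i, hi, hy.trans hx⟩
  have h := hac I hI
  rw [sumOn_eq_card, sumOn_eq_card] at h
  refine (Finset.card_le_card fun i hi => ?_).trans (h.trans (Finset.card_le_card fun a ha => ?_))
  · exact Finset.mem_filter.2 ⟨Finset.mem_univ _, i, hi, le_rfl⟩
  · obtain ⟨y, ⟨i, hi, hy⟩, hay⟩ := (Finset.mem_filter.1 ha).2
    exact Finset.mem_biUnion.2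
      ⟨i, hi, Finset.mem_filter.2 ⟨Finset.mem_univ _, hay.trans_le hy⟩⟩

lemma sum_filter_support_sum_single {ι σ : Type*} [Fintype ι] (g : ι → σ)
    (P : σ → Prop) [DecidablePred P] :
    ∑ p ∈ (∑ i, Finsupp.single (g i) 1 : σ →₀ ℕ).support.filter P,
      (∑ i, Finsupp.single (g i) 1 : σ →₀ ℕ) p = ∑ i, if P (g i) then 1 else 0 := by
  classical
  rw [Finset.sum_filter]
  change (∑ i, Finsupp.single (g i) 1 : σ →₀ ℕ).sum (fun p n => if P p then n else 0) = _
  rw [← Finsupp.sum_finsetSum_index (by simp) (by intros; split_ifs <;> simp)]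
  simp

/-- If `(β₀, β₁)` satisfies the rank equation and all antichain inequalities,
then it is a nonnegative integer combination of pure tables: there is a finitely
supported `c : Y± × Y± → ℕ`, supported on pairs `λ < μ`, whose row sums give
`β₀` and whose column sums give `β₁`. -/
theorem extremal_rays_pure (k : ℕ) (hk : 0 < k) (β₀ β₁ : YL k →₀ ℕ)
    (hrank : total β₀ = total β₁)
    (hac : ∀ I : Set (YL k), IsOrderIdeal I → sumOn β₁ I ≤ sumOn β₀ (idealInterior I)) :
    ∃ c : (YL k × YL k) →₀ ℕ,
      (∀ p : YL k × YL k, c p ≠ 0 → p.1 < p.2) ∧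
      (∀ lam : YL k, β₀ lam = ∑ p ∈ c.support.filter (fun p => p.1 = lam), c p) ∧
      (∀ mu : YL k, β₁ mu = ∑ p ∈ c.support.filter (fun p => p.2 = mu), c p) := by
  obtain ⟨f, hf, hlt⟩ := exists_injective_lt β₀ β₁ hac
  have hbij : Function.Bijective f := (Fintype.bijective_iff_injective_and_card f).2
    ⟨hf, by rw [← total_eq_card, ← total_eq_card, hrank]⟩
  refine ⟨∑ i : Copies β₁, Finsupp.single (((f i).1 : YL k), (i.1 : YL k)) 1, ?_, ?_, ?_⟩
  · intro p hp
    rw [Finsupp.finsetSum_apply] at hp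
    obtain ⟨i, -, hi⟩ := Finset.exists_ne_zero_of_sum_ne_zero hp
    obtain rfl := (Finsupp.single_apply_ne_zero.1 hi).1
    exact hlt i
  · intro lam
    rw [sum_filter_support_sum_single, ← sum_copies_ite_eq β₀ lam]
    exact (hbij.sum_comp fun a : Copies β₀ => if (a.1 : YL k) = lam then 1 else 0).symm
  · intro mu
    rw [sum_filter_support_sum_single, ← sum_copies_ite_eq β₁ mu]
end

section
/- Let β₀, β₁ : Y± → ℚ be finitely supported functions with nonnegative values. Then the following are equivalent: (a) the pair (β₀, β₁) satisfies the rank equation ∑_λ β₀(λ) = ∑_λ β₁(λ) and the antichain inequality ∑_{λ∈I°} β₀(λ) ≥ ∑_{λ∈I} β₁(λ) for every order ideal I ⊆ Y±; (b) there exist finitely many pairs λ⁽¹⁾ < μ⁽¹⁾, …, λ⁽ᵐ⁾ < μ⁽ᵐ⁾ in Y± and nonnegative rationals c₁, …, c_m such that (β₀, β₁) = ∑_{i=1}^m c_i · P(λ⁽ⁱ⁾, μ⁽ⁱ⁾). -/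
/-- A rank Betti table: a pair of finitely supported functions `Y± → ℚ`. -/
abbrev Table (k : ℕ) : Type := (YL k →₀ ℚ) × (YL k →₀ ℚ)

/-- The pure table `P(λ, μ)`: `β₀` is the indicator of `λ` and `β₁` is the
indicator of `μ`. -/
noncomputable def pureTable {k : ℕ} (lam mu : YL k) : Table k :=
  (Finsupp.single lam 1, Finsupp.single mu 1)

/-- Membership in the Boij–Söderberg cone cut out by nonnegativity, the rank
equation, and the antichain inequalities. -/
def InCone {k : ℕ} (B : Table k) : Prop :=
  (∀ x, 0 ≤ B.1 x) ∧ (∀ x, 0 ≤ B.2 x) ∧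
  total B.1 = total B.2 ∧
  ∀ I : Set (YL k), IsOrderIdeal I → sumOn B.2 I ≤ sumOn B.1 (idealInterior I)

theorem total_eq_sumOn_univ {k : ℕ} {M : Type*} [AddCommMonoid M] (β : YL k →₀ M) :
    total β = sumOn β Set.univ := by
  simp [total, sumOn]

theorem sumOn_sum_smul_single {k : ℕ} {ι : Type*} [Fintype ι] (c : ι → ℚ) (a : ι → YL k)
    (S : Set (YL k)) :
    sumOn (∑ i, c i • Finsupp.single (a i) (1 : ℚ)) S =
      ∑ i, S.indicator (fun _ => c i) (a i) := by
  classical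
  have key : ∀ β : YL k →₀ ℚ, sumOn β S = β.sum fun x q => if x ∈ S then q else 0 := fun β =>
    Finset.sum_congr rfl fun x _ => Set.indicator_apply S β x
  rw [key, ← Finsupp.sum_finsetSum_index]
  · refine Finset.sum_congr rfl fun i _ => ?_
    rw [Finsupp.smul_single, Finsupp.sum_single_index] <;> simp [Set.indicator_apply]
  · simp
  · intro x p q
    split_ifs <;> simp

open Classical in
theorem sumOn_sum_smul_single_const {k : ℕ} {ι : Type*} [Fintype ι] (c : ℚ) (a : ι → YL k)
    (S : Set (YL k)) :
    sumOn (∑ i, c • Finsupp.single (a i) (1 : ℚ)) S =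
      (Finset.univ.filter fun i => a i ∈ S).card * c := by
  rw [sumOn_sum_smul_single]
  simp [Set.indicator_apply, Finset.sum_ite]

/-- A finitely supported function whose values are natural multiples of `c` is `c` times the
counting function of a finite family. -/
theorem exists_eq_sum_smul_single {α : Type*} (β : α →₀ ℚ) (c : ℚ)
    (h : ∀ x, ∃ n : ℕ, β x = n * c) :
    ∃ (m : ℕ) (a : Fin m → α), β = ∑ i, c • Finsupp.single (a i) (1 : ℚ) := by
  classical
  choose n hn using h
  let e := Fintype.equivFin (Σ x : β.support, Fin (n x))
  refine ⟨_, fun i => (e.symm i).1, ?_⟩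
  rw [e.symm.sum_comp fun p => c • Finsupp.single (p.1 : α) (1 : ℚ), Fintype.sum_sigma]
  conv_lhs => rw [← Finsupp.sum_single β, Finsupp.sum, ← Finset.sum_coe_sort]
  refine Finset.sum_congr rfl fun x _ => ?_
  simp [hn x]

theorem exists_pos_forall_eq_natCast_mul {α : Type*} (s : Finset α) (f : α → ℚ)
    (hf : ∀ x, 0 ≤ f x) :
    ∃ N : ℕ, 0 < N ∧ ∀ M : ℕ, 0 < M → N ∣ M → ∀ x ∈ s, ∃ n : ℕ, f x = n * (M : ℚ)⁻¹ := by
  refine ⟨∏ x ∈ s, (f x).den, Finset.prod_pos fun x _ => (f x).den_pos, ?_⟩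
  intro M hM hNM x hx
  obtain ⟨d, hd⟩ := (Finset.dvd_prod_of_mem (fun x => (f x).den) hx).trans hNM
  refine ⟨(f x).num.toNat * d, ?_⟩
  have hnum : (((f x).num.toNat : ℕ) : ℚ) = (f x).num := by
    exact_mod_cast Int.toNat_of_nonneg (Rat.num_nonneg.2 (hf x))
  have hM' : (M : ℚ) ≠ 0 := by positivity
  rw [← div_eq_mul_inv, eq_div_iff hM', Nat.cast_mul, hnum, hd, Nat.cast_mul, ← mul_assoc,
    Rat.mul_den_eq_num]

/-- Two nonnegative finitely supported functions are multiples, by a common positive factor, of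
counting functions of finite families. -/
theorem exists_common_sum_smul_single {α : Type*} (β₀ β₁ : α →₀ ℚ)
    (h0 : ∀ x, 0 ≤ β₀ x) (h1 : ∀ x, 0 ≤ β₁ x) :
    ∃ (c : ℚ) (m n : ℕ) (a : Fin m → α) (b : Fin n → α), 0 < c ∧
      β₀ = ∑ i, c • Finsupp.single (a i) (1 : ℚ) ∧
      β₁ = ∑ i, c • Finsupp.single (b i) (1 : ℚ) := by
  obtain ⟨N₀, hN₀, hβ₀⟩ := exists_pos_forall_eq_natCast_mul β₀.support β₀ h0
  obtain ⟨N₁, hN₁, hβ₁⟩ := exists_pos_forall_eq_natCast_mul β₁.support β₁ h1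
  have hN : 0 < N₀ * N₁ := Nat.mul_pos hN₀ hN₁
  have extend : ∀ β : α →₀ ℚ,
      (∀ x ∈ β.support, ∃ n : ℕ, β x = n * ((N₀ * N₁ : ℕ) : ℚ)⁻¹) →
      ∀ x, ∃ n : ℕ, β x = n * ((N₀ * N₁ : ℕ) : ℚ)⁻¹ := by
    intro β h x
    by_cases hx : x ∈ β.support
    · exact h x hx
    · exact ⟨0, by simpa using hx⟩
  obtain ⟨m, a, ha⟩ := exists_eq_sum_smul_single β₀ _
    (extend β₀ (hβ₀ _ hN (dvd_mul_right _ _)))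
  obtain ⟨n, b, hb⟩ := exists_eq_sum_smul_single β₁ _
    (extend β₁ (hβ₁ _ hN (dvd_mul_left _ _)))
  exact ⟨_, m, n, a, b, by positivity, ha, hb⟩

/-- Hall's theorem for the strict order: the antichain inequalities for two finite families
match the second family injectively to strictly smaller members of the first. -/
theorem exists_injective_lt_of_sumOn_le {k : ℕ} {ι κ : Type*} [Fintype ι] [Fintype κ]
    (a : ι → YL k) (b : κ → YL k) {c : ℚ} (hc : 0 < c)
    (h : ∀ I : Set (YL k), IsOrderIdeal I →
      sumOn (∑ j, c • Finsupp.single (b j) (1 : ℚ)) I ≤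
        sumOn (∑ i, c • Finsupp.single (a i) (1 : ℚ)) (idealInterior I)) :
    ∃ f : κ → ι, Function.Injective f ∧ ∀ j, a (f j) < b j := by
  classical
  refine (Fintype.all_card_le_filter_rel_iff_exists_injective
    fun (j : κ) (i : ι) => a i < b j).1 fun S => ?_
  obtain ⟨I, mem_I⟩ : ∃ I : Set (YL k), ∀ x, x ∈ I ↔ ∃ j ∈ S, x ≤ b j := ⟨_, fun _ => Iff.rfl⟩
  have hI := h I fun x hx y hy => by
    obtain ⟨j, hj, hxj⟩ := (mem_I x).1 hx
    exact (mem_I y).2 ⟨j, hj, hy.trans hxj⟩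
  rw [sumOn_sum_smul_single_const, sumOn_sum_smul_single_const, mul_le_mul_iff_left₀ hc,
    Nat.cast_le] at hI
  refine (Finset.card_le_card fun j hj => ?_).trans (hI.trans (Finset.card_le_card fun i hi => ?_))
  · exact Finset.mem_filter.2 ⟨Finset.mem_univ _, (mem_I _).2 ⟨j, hj, le_rfl⟩⟩
  · obtain ⟨y, hyI, hlt⟩ := (Finset.mem_filter.1 hi).2
    obtain ⟨j, hj, hy⟩ := (mem_I y).1 hyI
    exact Finset.mem_filter.2 ⟨Finset.mem_univ _, j, hj, hlt.trans_le hy⟩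

theorem sum_smul_pureTable {k : ℕ} {ι : Type*} [Fintype ι] (c : ι → ℚ) (lam mu : ι → YL k) :
    ∑ i, c i • pureTable (lam i) (mu i) =
      (∑ i, c i • Finsupp.single (lam i) (1 : ℚ), ∑ i, c i • Finsupp.single (mu i) (1 : ℚ)) := by
  ext1 <;> simp [pureTable, Prod.fst_sum, Prod.snd_sum]

/-- A nonnegative rank Betti table satisfies the rank equation and all antichain
inequalities if and only if it is a nonnegative rational combination of pure
tables `P(λ, μ)` with `λ < μ`. -/
theorem cone_description (k : ℕ) (hk : 0 < k) (β₀ β₁ : YL k →₀ ℚ)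
    (h0 : ∀ x, 0 ≤ β₀ x) (h1 : ∀ x, 0 ≤ β₁ x) :
    (total β₀ = total β₁ ∧
      ∀ I : Set (YL k), IsOrderIdeal I → sumOn β₁ I ≤ sumOn β₀ (idealInterior I)) ↔
    (∃ (m : ℕ) (lam mu : Fin m → YL k) (c : Fin m → ℚ),
      (∀ i, lam i < mu i) ∧ (∀ i, 0 ≤ c i) ∧
      (β₀, β₁) = ∑ i : Fin m, c i • pureTable (lam i) (mu i)) := by
  constructor
  · rintro ⟨htot, hI⟩
    obtain ⟨c, m, n, a, b, hc, rfl, rfl⟩ := exists_common_sum_smul_single β₀ β₁ h0 h1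
    obtain ⟨f, hf, hlt⟩ := exists_injective_lt_of_sumOn_le a b hc hI
    have hmn : m = n := by
      rw [total_eq_sumOn_univ, total_eq_sumOn_univ, sumOn_sum_smul_single,
        sumOn_sum_smul_single] at htot
      simpa [hc.ne'] using htot
    subst hmn
    have hbij := Finite.injective_iff_bijective.1 hf
    refine ⟨m, fun i => a (f i), b, fun _ => c, hlt, fun _ => hc.le, ?_⟩
    rw [sum_smul_pureTable, hbij.sum_comp fun i => c • Finsupp.single (a i) (1 : ℚ)]
  · rintro ⟨m, lam, mu, c, hlt, hc, h⟩
    rw [sum_smul_pureTable, Prod.mk.injEq] at h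
    obtain ⟨rfl, rfl⟩ := h
    refine ⟨?_, fun I _ => ?_⟩
    · rw [total_eq_sumOn_univ, total_eq_sumOn_univ, sumOn_sum_smul_single, sumOn_sum_smul_single]
      simp
    rw [sumOn_sum_smul_single, sumOn_sum_smul_single]
    refine Finset.sum_le_sum fun i _ => ?_
    by_cases hi : mu i ∈ I
    · have hlam : lam i ∈ idealInterior I := ⟨mu i, hi, hlt i⟩
      rw [Set.indicator_of_mem hi, Set.indicator_of_mem hlam]
    · rw [Set.indicator_of_notMem hi]
      exact Set.indicator_nonneg (fun _ _ => hc i) _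
end

section
/- Let λ < μ in Y± and let B = (β₀, β₁) and B' = (β₀', β₁') be rank Betti tables, each with nonnegative values, each satisfying the rank equation and the antichain inequality for every order ideal of Y±. If B + B' = q · P(λ, μ) for some rational q ≥ 0, then there exist nonnegative rationals a and a' with B = a · P(λ, μ) and B' = a' · P(λ, μ). In other words, each pure table spans an extremal ray of the cone cut out by nonnegativity, the rank equation, and the antichain inequalities. -/
theorem Finsupp.eq_single_of_add_eq_single {α M : Type*} [AddCommMonoid M] [PartialOrder M]
    [IsOrderedAddMonoid M] {f g : α →₀ M} {a : α} {c : M} (hf : ∀ x, 0 ≤ f x)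
    (hg : ∀ x, 0 ≤ g x) (h : f + g = Finsupp.single a c) : f = Finsupp.single a (f a) := by
  classical
  ext x
  rcases eq_or_ne x a with rfl | hx
  · simp
  · have hsum : f x + g x = 0 := by
      simpa [Finsupp.single_eq_of_ne hx] using DFunLike.congr_fun h x
    rw [Finsupp.single_eq_of_ne hx]
    exact ((add_eq_zero_iff_of_nonneg (hf x) (hg x)).1 hsum).1

theorem total_single {k : ℕ} {M : Type*} [AddCommMonoid M] (x : YL k) (c : M) :
    total (Finsupp.single x c) = c :=
  Finsupp.sum_single_index (h := fun _ b => b) rfl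

theorem InCone.eq_smul_pureTable {k : ℕ} {lam mu : YL k} {B B' : Table k} (hB : InCone B)
    (hB' : InCone B') {q : ℚ} (hsum : B + B' = q • pureTable lam mu) :
    B = B.1 lam • pureTable lam mu := by
  have h₁ : B.1 = Finsupp.single lam (B.1 lam) :=
    Finsupp.eq_single_of_add_eq_single hB.1 hB'.1
      (by simpa [pureTable] using congrArg Prod.fst hsum)
  have h₂ : B.2 = Finsupp.single mu (B.2 mu) :=
    Finsupp.eq_single_of_add_eq_single hB.2.1 hB'.2.1
      (by simpa [pureTable] using congrArg Prod.snd hsum)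
  have hrank : B.1 lam = B.2 mu := by
    have h := hB.2.2.1
    rwa [h₁, h₂, total_single, total_single] at h
  refine Prod.ext ?_ ?_
  · simpa [pureTable] using h₁
  · simpa [pureTable, hrank] using h₂

/-- Each pure table spans an extremal ray of the cone: if a sum of two tables in
the cone is a nonnegative multiple of a pure table `P(λ, μ)`, then each summand
is itself a nonnegative multiple of `P(λ, μ)`. -/
theorem pureTable_extremal (k : ℕ) (hk : 0 < k) (lam mu : YL k) (hlt : lam < mu)
    (B B' : Table k) (hB : InCone B) (hB' : InCone B')
    (q : ℚ) (hq : 0 ≤ q) (hsum : B + B' = q • pureTable lam mu) :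
    ∃ a a' : ℚ, 0 ≤ a ∧ 0 ≤ a' ∧
      B = a • pureTable lam mu ∧ B' = a' • pureTable lam mu := by
  exact ⟨B.1 lam, B'.1 lam, hB.1 lam, hB'.1 lam, hB.eq_smul_pureTable hB' hsum,
    hB'.eq_smul_pureTable hB (by rwa [add_comm])⟩
end

section
/- Let B = (β₀, β₁) be a rank Betti table with nonnegative values satisfying the rank equation and the antichain inequality for every order ideal of Y±. Then for every upward-closed subset U ⊆ Y±, the dual inequality ∑_{λ ∈ U} β₀(λ) ≤ ∑_{λ ∈ U_∘} β₁(λ) holds, where U_∘ = {λ ∈ U : μ < λ for some μ ∈ U} is the upward interior of U. -/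
/-- An upward-closed subset of `Y±`. -/
def IsUpwardClosed {k : ℕ} (U : Set (YL k)) : Prop :=
  ∀ ⦃x⦄, x ∈ U → ∀ ⦃y⦄, x ≤ y → y ∈ U

/-- The upward interior `U_∘ = {λ ∈ U : μ < λ for some μ ∈ U}`. -/
def upInterior {k : ℕ} (U : Set (YL k)) : Set (YL k) :=
  {x | x ∈ U ∧ ∃ y ∈ U, y < x}

theorem sumOn_add_sumOn_compl {k : ℕ} {M : Type*} [AddCommMonoid M]
    (β : YL k →₀ M) (S : Set (YL k)) : sumOn β S + sumOn β Sᶜ = total β := by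
  simp only [sumOn, total, ← Finset.sum_add_distrib, Set.indicator_self_add_compl_apply]

theorem sumOn_mono {k : ℕ} {β : YL k →₀ ℚ} (hβ : ∀ x, 0 ≤ β x) {S T : Set (YL k)}
    (h : S ⊆ T) : sumOn β S ≤ sumOn β T :=
  Finset.sum_le_sum fun x _ => Set.indicator_le_indicator_of_subset h hβ x

theorem IsUpwardClosed.isOrderIdeal_compl_upInterior {k : ℕ} {U : Set (YL k)}
    (hU : IsUpwardClosed U) : IsOrderIdeal (upInterior U)ᶜ := by
  rintro x hx y hyx ⟨hy, z, hz, hzy⟩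
  exact hx ⟨hU hy hyx, z, hz, hzy.trans_le hyx⟩

theorem IsUpwardClosed.idealInterior_compl_upInterior_subset {k : ℕ} {U : Set (YL k)}
    (hU : IsUpwardClosed U) : idealInterior (upInterior U)ᶜ ⊆ Uᶜ := by
  rintro x ⟨y, hy, hxy⟩ hx
  exact hy ⟨hU hx hxy.le, x, hx, hxy⟩

/-- A table in the cone satisfies, for every upward-closed subset `U`, the dual
inequality `∑_{λ ∈ U} β₀(λ) ≤ ∑_{λ ∈ U_∘} β₁(λ)`. -/
theorem dual_inequality (k : ℕ) (hk : 0 < k) (β₀ β₁ : YL k →₀ ℚ)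
    (hB : InCone (β₀, β₁)) :
    ∀ U : Set (YL k), IsUpwardClosed U →
      sumOn β₀ U ≤ sumOn β₁ (upInterior U) := by
  intro U hU
  obtain ⟨h₀, -, htotal, hideal⟩ := hB
  have hle := (hideal _ hU.isOrderIdeal_compl_upInterior).trans
    (sumOn_mono h₀ hU.idealInterior_compl_upInterior_subset)
  have hU₀ := sumOn_add_sumOn_compl β₀ U
  have hU₁ := sumOn_add_sumOn_compl β₁ (upInterior U)
  dsimp only at hle htotal
  linarith
end

section
/- Let β₀, β₁ : Y± → ℕ be finitely supported functions with ∑_λ β₀(λ) = ∑_λ β₁(λ). Let G be the bipartite graph whose left vertices are the pairs (λ, i) with λ ∈ Y± and i ∈ Fin (β₀(λ)), whose right vertices are the pairs (μ, j) with μ ∈ Y± and j ∈ Fin (β₁(μ)), and with an edge joining (λ, i) to (μ, j) if and only if λ < μ. Then G has a perfect matching if and only if the antichain inequality ∑_{λ∈I°} β₀(λ) ≥ ∑_{λ∈I} β₁(λ) holds for every order ideal I ⊆ Y±. -/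
/-- The bipartite graph whose left vertices are pairs `(λ, i)` with
`i ∈ Fin (β₀ λ)`, whose right vertices are pairs `(μ, j)` with `j ∈ Fin (β₁ μ)`,
and with an edge from `(λ, i)` to `(μ, j)` exactly when `λ < μ`. -/
def bettiGraph {k : ℕ} (β₀ β₁ : YL k →₀ ℕ) :
    SimpleGraph ((Σ lam : YL k, Fin (β₀ lam)) ⊕ (Σ mu : YL k, Fin (β₁ mu))) :=
  SimpleGraph.fromRel (fun x y =>
    match x, y with
    | Sum.inl a, Sum.inr b => a.1 < b.1
    | _, _ => False)

/-- The vertices `(x, i)` with `i ∈ Fin (β x)`, for a finitely supported `β`, form a finite type. -/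
instance sigmaFinFintype {k : ℕ} (β : YL k →₀ ℕ) : Fintype (Σ x : YL k, Fin (β x)) where
  elems := β.support.sigma fun _ => Finset.univ
  complete := by
    rintro ⟨x, i⟩
    have hx : β x ≠ 0 := (Fin.pos i).ne'
    simpa using hx

theorem card_filter_fst_mem {k : ℕ} (β : YL k →₀ ℕ) (S : Set (YL k)) [DecidablePred (· ∈ S)] :
    (Finset.univ.filter fun p : Σ x : YL k, Fin (β x) => p.1 ∈ S).card = sumOn β S := by
  have h : (Finset.univ.filter fun p : Σ x : YL k, Fin (β x) => p.1 ∈ S) =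
      (β.support.filter (· ∈ S)).sigma fun _ => Finset.univ := by
    ext ⟨x, i⟩
    have hx : β x ≠ 0 := (Fin.pos i).ne'
    simp [hx]
  rw [h, Finset.card_sigma, sumOn, Finset.sum_filter]
  exact Finset.sum_congr rfl fun x _ => by simp [Set.indicator_apply]

theorem card_sigma_fin_eq_total {k : ℕ} (β : YL k →₀ ℕ) :
    Fintype.card (Σ x : YL k, Fin (β x)) = total β := by
  classical
  have h := card_filter_fst_mem β Set.univ
  simpa [sumOn, total] using h

theorem bettiGraph_adj_inl_inr {k : ℕ} {β₀ β₁ : YL k →₀ ℕ}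
    (a : Σ x : YL k, Fin (β₀ x)) (b : Σ x : YL k, Fin (β₁ x)) :
    (bettiGraph β₀ β₁).Adj (Sum.inl a) (Sum.inr b) ↔ a.1 < b.1 := by
  simp [bettiGraph]

theorem not_bettiGraph_adj_inl_inl {k : ℕ} {β₀ β₁ : YL k →₀ ℕ}
    (a a' : Σ x : YL k, Fin (β₀ x)) :
    ¬ (bettiGraph β₀ β₁).Adj (Sum.inl a) (Sum.inl a') := by
  simp [bettiGraph]

theorem not_bettiGraph_adj_inr_inr {k : ℕ} {β₀ β₁ : YL k →₀ ℕ}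
    (b b' : Σ x : YL k, Fin (β₁ x)) :
    ¬ (bettiGraph β₀ β₁).Adj (Sum.inr b) (Sum.inr b') := by
  simp [bettiGraph]

/-- The subgraph of `bettiGraph` whose edges join `f b` to `b`. -/
def bettiSubgraphOfFun {k : ℕ} {β₀ β₁ : YL k →₀ ℕ}
    (f : (Σ x : YL k, Fin (β₁ x)) → Σ x : YL k, Fin (β₀ x)) (hf : ∀ b, (f b).1 < b.1) :
    (bettiGraph β₀ β₁).Subgraph where
  verts := Set.univ
  Adj x y := ∃ b, (x = Sum.inl (f b) ∧ y = Sum.inr b) ∨ (x = Sum.inr b ∧ y = Sum.inl (f b))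
  adj_sub := by
    rintro x y ⟨b, ⟨rfl, rfl⟩ | ⟨rfl, rfl⟩⟩
    · exact (bettiGraph_adj_inl_inr _ _).2 (hf b)
    · exact ((bettiGraph_adj_inl_inr _ _).2 (hf b)).symm
  edge_vert _ := Set.mem_univ _
  symm := ⟨fun _ _ ⟨b, h⟩ => ⟨b, h.symm.imp And.symm And.symm⟩⟩

/-- Perfect matchings of `bettiGraph` correspond to bijections from the right to the left vertices
that decrease the lattice component. -/
theorem exists_isPerfectMatching_iff_exists_bijective {k : ℕ} {β₀ β₁ : YL k →₀ ℕ} :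
    (∃ M : (bettiGraph β₀ β₁).Subgraph, M.IsPerfectMatching) ↔
      ∃ f : (Σ x : YL k, Fin (β₁ x)) → Σ x : YL k, Fin (β₀ x),
        Function.Bijective f ∧ ∀ b, (f b).1 < b.1 := by
  constructor
  · rintro ⟨M, hM⟩
    rw [SimpleGraph.Subgraph.isPerfectMatching_iff] at hM
    have hr : ∀ b, ∃ a, M.Adj (Sum.inr b) (Sum.inl a) := by
      intro b
      obtain ⟨a | b', h, -⟩ := hM (Sum.inr b)
      · exact ⟨a, h⟩
      · exact absurd h.adj_sub (not_bettiGraph_adj_inr_inr b b')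
    choose f hf using hr
    refine ⟨f, ⟨fun b b' h => ?_, fun a => ?_⟩, fun b =>
      (bettiGraph_adj_inl_inr _ _).1 (hf b).symm.adj_sub⟩
    · have h' := (hf b').symm
      rw [← h] at h'
      exact Sum.inr_injective ((hM _).unique (hf b).symm h')
    · obtain ⟨a' | b, h, -⟩ := hM (Sum.inl a)
      · exact absurd h.adj_sub (not_bettiGraph_adj_inl_inl a a')
      · exact ⟨b, Sum.inl_injective ((hM _).unique (hf b) h.symm)⟩
  · rintro ⟨f, hbij, hf⟩
    refine ⟨bettiSubgraphOfFun f hf, SimpleGraph.Subgraph.isPerfectMatching_iff.2 ?_⟩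
    rintro (a | b)
    · obtain ⟨b, rfl⟩ := hbij.2 a
      refine ⟨Sum.inr b, ⟨b, Or.inl ⟨rfl, rfl⟩⟩, ?_⟩
      rintro y ⟨b', ⟨h, rfl⟩ | ⟨h, rfl⟩⟩
      · rw [hbij.1 (Sum.inl_injective h)]
      · exact absurd h Sum.inl_ne_inr
    · refine ⟨Sum.inl (f b), ⟨b, Or.inr ⟨rfl, rfl⟩⟩, ?_⟩
      rintro y ⟨b', ⟨h, rfl⟩ | ⟨h, rfl⟩⟩
      · exact absurd h Sum.inr_ne_inl
      · rw [Sum.inr_injective h]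

/-- Hall-type criterion: assuming the rank equation, the bipartite graph built
from a rank Betti table has a perfect matching if and only if every antichain
inequality holds. -/
theorem perfectMatching_iff_antichain (k : ℕ) (hk : 0 < k) (β₀ β₁ : YL k →₀ ℕ)
    (hrank : total β₀ = total β₁) :
    (∃ M : (bettiGraph β₀ β₁).Subgraph, M.IsPerfectMatching) ↔
    (∀ I : Set (YL k), IsOrderIdeal I → sumOn β₁ I ≤ sumOn β₀ (idealInterior I)) := by
  classical
  have hcard : Fintype.card (Σ x : YL k, Fin (β₁ x)) = Fintype.card (Σ x : YL k, Fin (β₀ x)) := by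
    rw [card_sigma_fin_eq_total, card_sigma_fin_eq_total, hrank]
  rw [exists_isPerfectMatching_iff_exists_bijective]
  constructor
  · rintro ⟨f, hbij, hf⟩ I -
    rw [← card_filter_fst_mem, ← card_filter_fst_mem]
    refine Finset.card_le_card_of_injOn f (fun b hb => ?_) hbij.1.injOn
    simp only [Finset.coe_filter, Finset.mem_univ, true_and, Set.mem_ofPred_eq] at hb ⊢
    exact ⟨b.1, hb, hf b⟩
  · intro h
    obtain ⟨f, hinj, hf⟩ := (Fintype.all_card_le_filter_rel_iff_exists_injective
      fun (b : Σ x : YL k, Fin (β₁ x)) (a : Σ x : YL k, Fin (β₀ x)) => a.1 < b.1).1 fun A => by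
        have hI : IsOrderIdeal {x : YL k | ∃ b ∈ A, x ≤ b.1} :=
          fun x ⟨b, hb, hx⟩ y hy => ⟨b, hb, hy.trans hx⟩
        have hA := h _ hI
        rw [← card_filter_fst_mem, ← card_filter_fst_mem] at hA
        refine (Finset.card_le_card fun b hb => ?_).trans (hA.trans (Finset.card_le_card ?_))
        · exact Finset.mem_filter.2 ⟨Finset.mem_univ _, b, hb, le_rfl⟩
        · intro a ha
          obtain ⟨y, ⟨b, hb, hy⟩, hay⟩ := (Finset.mem_filter.1 ha).2
          exact Finset.mem_filter.2 ⟨Finset.mem_univ _, b, hb, hay.trans_le hy⟩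
    exact ⟨f, (Fintype.bijective_iff_injective_and_card f).2 ⟨hinj, hcard⟩, hf⟩
end

section
/- Let B = (β₀, β₁) be a nonzero rank Betti table with nonnegative values satisfying the rank equation and the antichain inequality for every order ideal of Y±, and suppose B is extremal, i.e. whenever B = B₁ + B₂ with B₁, B₂ both nonnegative tables satisfying the rank equation and all antichain inequalities, each Bᵢ is a rational scalar multiple of B. Then B is a positive rational multiple of the pure table P(λ, μ) for some pair λ < μ in Y±. Hence the extremal rays of the cone are exactly the rays spanned by the pure tables, indexed by comparable pairs λ < μ of weakly decreasing integer sequences. -/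
section SumOn

variable {k : ℕ}

open scoped Classical in
lemma sumOn_eq_sum {M : Type*} [AddCommMonoid M] (β : YL k →₀ M) (S : Set (YL k)) :
    sumOn β S = β.sum fun x v => if x ∈ S then v else 0 := by
  simp [sumOn, Finsupp.sum, Set.indicator_apply]

lemma sumOn_univ {M : Type*} [AddCommMonoid M] (β : YL k →₀ M) :
    sumOn β Set.univ = total β := by
  simp [sumOn, total]

lemma sumOn_sub {M : Type*} [AddCommGroup M] (β γ : YL k →₀ M) (S : Set (YL k)) :
    sumOn (β - γ) S = sumOn β S - sumOn γ S := by
  classical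
  simp only [sumOn_eq_sum]
  refine Finsupp.sum_sub_index fun x v w => ?_
  split_ifs <;> simp

open scoped Classical in
lemma sumOn_single {M : Type*} [AddCommMonoid M] (x : YL k) (v : M) (S : Set (YL k)) :
    sumOn (Finsupp.single x v) S = if x ∈ S then v else 0 := by
  rw [sumOn_eq_sum, Finsupp.sum_single_index (by simp)]

/-- If `N * β = b` pointwise with `b` integral, the same holds for the sums over any set. -/
lemma sumOn_natCast {N : ℚ} {β : YL k →₀ ℚ} {b : YL k →₀ ℕ} (hb : ∀ x, N * β x = b x)
    (S : Set (YL k)) : N * sumOn β S = ((sumOn b S : ℕ) : ℚ) := by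
  classical
  have h : N • β = b.mapRange (Nat.cast : ℕ → ℚ) Nat.cast_zero := by
    ext x
    simp [hb]
  calc N * sumOn β S = sumOn (N • β) S := by
        rw [sumOn_eq_sum, sumOn_eq_sum, Finsupp.sum_smul_index (by simp)]
        simp [Finsupp.mul_sum]
    _ = ((sumOn b S : ℕ) : ℚ) := by
        rw [h, sumOn_eq_sum, sumOn_eq_sum, Finsupp.sum_mapRange_index (by simp)]
        simp [Finsupp.sum]

/-- The finite set containing `b x` labelled copies of each `x`. -/
def copies (b : YL k →₀ ℕ) : Finset (Σ _ : YL k, ℕ) :=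
  b.support.sigma fun x => Finset.range (b x)

lemma mem_copies {b : YL k →₀ ℕ} {p : Σ _ : YL k, ℕ} : p ∈ copies b ↔ p.2 < b p.1 := by
  simp only [copies, Finset.mem_sigma, Finsupp.mem_support_iff, Finset.mem_range]
  omega

open scoped Classical in
lemma card_copies_filter (b : YL k →₀ ℕ) (S : Set (YL k)) :
    ((copies b).filter fun p => p.1 ∈ S).card = sumOn b S := by
  have h : ((copies b).filter fun p => p.1 ∈ S) =
      (b.support.filter (· ∈ S)).sigma fun x => Finset.range (b x) := by
    ext p
    simp only [copies, Finset.mem_filter, Finset.mem_sigma]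
    tauto
  rw [h, Finset.card_sigma]
  simp [sumOn, Set.indicator_apply, Finset.sum_filter]

/-- Hall's theorem: the antichain inequalities give an injection of the copies for `b₁` into
the copies for `b₀` that strictly decreases the underlying sequence. -/
lemma exists_matching {b₀ b₁ : YL k →₀ ℕ}
    (h : ∀ I : Set (YL k), IsOrderIdeal I → sumOn b₁ I ≤ sumOn b₀ (idealInterior I)) :
    ∃ f : copies b₁ → Σ _ : YL k, ℕ, Function.Injective f ∧
      ∀ a, f a ∈ copies b₀ ∧ (f a).1 < a.1.1 := by
  classical
  have key := (Finset.all_card_le_biUnion_card_iff_exists_injective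
    (fun a : copies b₁ => (copies b₀).filter fun c => c.1 < a.1.1)).1 ?_
  · simpa only [Finset.mem_filter] using key
  have hcard : ∀ I : Set (YL k), IsOrderIdeal I →
      ((copies b₁).filter fun p => p.1 ∈ I).card ≤
        ((copies b₀).filter fun p => p.1 ∈ idealInterior I).card := by
    intro I hI
    rw [card_copies_filter, card_copies_filter]
    exact h I hI
  intro s
  obtain ⟨I, hmem⟩ : ∃ I : Set (YL k), ∀ x, x ∈ I ↔ ∃ a ∈ s, x ≤ a.1.1 :=
    ⟨{x | ∃ a ∈ s, x ≤ a.1.1}, fun _ => Iff.rfl⟩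
  have hI : IsOrderIdeal I := by
    intro x hx y hy
    obtain ⟨a, ha, hxa⟩ := (hmem x).1 hx
    exact (hmem y).2 ⟨a, ha, hy.trans hxa⟩
  rw [← Finset.card_map (Function.Embedding.subtype _)]
  refine (Finset.card_le_card fun p hp => ?_).trans
    ((hcard I hI).trans (Finset.card_le_card fun p hp => ?_))
  · obtain ⟨a, ha, rfl⟩ := Finset.mem_map.1 hp
    exact Finset.mem_filter.2 ⟨a.2, (hmem _).2 ⟨a, ha, le_rfl⟩⟩
  · obtain ⟨hp, y, hyI, hlt⟩ := Finset.mem_filter.1 hp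
    obtain ⟨a, ha, hy⟩ := (hmem y).1 hyI
    exact Finset.mem_biUnion.2 ⟨a, ha, Finset.mem_filter.2 ⟨hp, hlt.trans_le hy⟩⟩

open scoped Classical in
/-- A nonzero integral table satisfying the antichain inequalities has a comparable pair that
can be removed without violating them. -/
lemma exists_removable_pair {b₀ b₁ : YL k →₀ ℕ}
    (h : ∀ I : Set (YL k), IsOrderIdeal I → sumOn b₁ I ≤ sumOn b₀ (idealInterior I))
    (hb₁ : b₁ ≠ 0) :
    ∃ lam mu : YL k, lam < mu ∧ 0 < b₀ lam ∧ 0 < b₁ mu ∧ ∀ I : Set (YL k), IsOrderIdeal I →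
      sumOn b₁ I + (if lam ∈ idealInterior I then 1 else 0) ≤
        sumOn b₀ (idealInterior I) + if mu ∈ I then 1 else 0 := by
  obtain ⟨f, hinj, hf⟩ := exists_matching h
  obtain ⟨mu, hmu⟩ := Finsupp.ne_iff.1 hb₁
  have hmu : 0 < b₁ mu := Nat.pos_of_ne_zero hmu
  let a : copies b₁ := ⟨⟨mu, 0⟩, mem_copies.2 hmu⟩
  have ha := hf a
  refine ⟨(f a).1, mu, ha.2, (mem_copies.1 ha.1).pos, hmu, fun I hI => ?_⟩
  by_cases hm : mu ∈ I
  · have := h I hI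
    rw [if_pos hm]
    split_ifs <;> omega
  by_cases hl : (f a).1 ∈ idealInterior I
  swap
  · simpa [hm, hl] using h I hI
  rw [if_neg hm, if_pos hl, ← card_copies_filter, ← card_copies_filter, add_zero,
    Nat.add_one_le_iff]
  let g : (Σ _ : YL k, ℕ) → Σ _ : YL k, ℕ := fun p => if hp : p ∈ copies b₁ then f ⟨p, hp⟩ else p
  have hg : ∀ p (hp : p ∈ copies b₁), g p = f ⟨p, hp⟩ := fun p hp => dif_pos hp
  have himg : (((copies b₁).filter fun p => p.1 ∈ I).image g).card =
      ((copies b₁).filter fun p => p.1 ∈ I).card := by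
    refine Finset.card_image_of_injOn fun p hp q hq hpq => ?_
    have hp := (Finset.mem_filter.1 hp).1
    have hq := (Finset.mem_filter.1 hq).1
    rw [hg p hp, hg q hq] at hpq
    exact congrArg Subtype.val (hinj hpq)
  rw [← himg]
  refine Finset.card_lt_card ((Finset.ssubset_iff_of_subset fun c hc => ?_).2
    ⟨f a, Finset.mem_filter.2 ⟨ha.1, hl⟩, fun hc => ?_⟩)
  · obtain ⟨p, hp, rfl⟩ := Finset.mem_image.1 hc
    obtain ⟨hp, hpI⟩ := Finset.mem_filter.1 hp
    rw [hg p hp]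
    exact Finset.mem_filter.2 ⟨(hf _).1, p.1, hpI, (hf _).2⟩
  · obtain ⟨p, hp, hpa⟩ := Finset.mem_image.1 hc
    obtain ⟨hp, hpI⟩ := Finset.mem_filter.1 hp
    rw [hg p hp] at hpa
    have hpm : p.1 = mu := congrArg (fun q : copies b₁ => q.1.1) (hinj hpa)
    exact hm (hpm ▸ hpI)

lemma exists_pos_natCast_eq_mul (s : Finset ℚ) (hs : ∀ q ∈ s, 0 ≤ q) :
    ∃ N : ℕ, 0 < N ∧ ∀ q ∈ s, ∃ n : ℕ, (N : ℚ) * q = n := by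
  refine ⟨∏ q ∈ s, q.den, Finset.prod_pos fun q _ => q.pos, fun q hq => ?_⟩
  obtain ⟨m, hm⟩ := Finset.dvd_prod_of_mem Rat.den hq
  refine ⟨m * q.num.toNat, ?_⟩
  have h : ((q.num.toNat : ℕ) : ℚ) = q.num := by
    exact_mod_cast Int.toNat_of_nonneg (Rat.num_nonneg.2 (hs q hq))
  rw [hm]
  push_cast
  rw [h, ← Rat.den_mul_eq_num q]
  ring

/-- A nonnegative table becomes integral after scaling by a positive integer. -/
lemma exists_integral_multiple {B : Table k} (h₀ : ∀ x, 0 ≤ B.1 x) (h₁ : ∀ x, 0 ≤ B.2 x) :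
    ∃ N : ℚ, 0 < N ∧ ∃ b₀ b₁ : YL k →₀ ℕ,
      (∀ x, N * B.1 x = b₀ x) ∧ ∀ x, N * B.2 x = b₁ x := by
  classical
  obtain ⟨N, hN, h⟩ := exists_pos_natCast_eq_mul
    (insert 0 (B.1.support.image B.1 ∪ B.2.support.image B.2)) (by
      intro q hq
      simp only [Finset.mem_insert, Finset.mem_union, Finset.mem_image] at hq
      obtain rfl | ⟨x, -, rfl⟩ | ⟨x, -, rfl⟩ := hq
      exacts [le_rfl, h₀ x, h₁ x])
  have hfloor : ∀ q ∈ insert 0 (B.1.support.image B.1 ∪ B.2.support.image B.2),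
      (N : ℚ) * q = (⌊(N : ℚ) * q⌋₊ : ℕ) := by
    intro q hq
    obtain ⟨n, hn⟩ := h q hq
    rw [hn, Nat.floor_natCast]
  refine ⟨N, by exact_mod_cast hN, B.1.mapRange (fun q => ⌊(N : ℚ) * q⌋₊) (by simp),
    B.2.mapRange (fun q => ⌊(N : ℚ) * q⌋₊) (by simp), fun x => ?_, fun x => ?_⟩
  · rw [Finsupp.mapRange_apply]
    refine hfloor _ ?_
    by_cases hx : B.1 x = 0
    · simp [hx]
    · exact Finset.mem_insert_of_mem (Finset.mem_union_left _
        (Finset.mem_image_of_mem _ (Finsupp.mem_support_iff.2 hx)))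
  · rw [Finsupp.mapRange_apply]
    refine hfloor _ ?_
    by_cases hx : B.2 x = 0
    · simp [hx]
    · exact Finset.mem_insert_of_mem (Finset.mem_union_right _
        (Finset.mem_image_of_mem _ (Finsupp.mem_support_iff.2 hx)))

lemma smul_pureTable (q : ℚ) (lam mu : YL k) :
    q • pureTable lam mu = (Finsupp.single lam q, Finsupp.single mu q) := by
  simp [pureTable]

lemma inCone_smul_pureTable {q : ℚ} (hq : 0 ≤ q) {lam mu : YL k} (h : lam < mu) :
    InCone (q • pureTable lam mu) := by
  classical
  rw [smul_pureTable]
  refine ⟨fun x => ?_, fun x => ?_, ?_, fun I hI => ?_⟩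
  · simp only [Finsupp.single_apply]; split_ifs <;> simp [hq]
  · simp only [Finsupp.single_apply]; split_ifs <;> simp [hq]
  · simp [← sumOn_univ, sumOn_single]
  · simp only [sumOn_single]
    by_cases hm : mu ∈ I
    · rw [if_pos hm, if_pos ⟨mu, hm, h⟩]
    · rw [if_neg hm]; split_ifs <;> simp [hq]

/-- From a nonzero table in the cone one can split off a positive multiple of a pure table. -/
lemma exists_sub_pureTable_inCone {B : Table k} (hB : InCone B) (hne : B ≠ 0) :
    ∃ lam mu : YL k, lam < mu ∧ ∃ q : ℚ, 0 < q ∧ InCone (B - q • pureTable lam mu) := by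
  classical
  obtain ⟨h₀, h₁, htot, hideal⟩ := hB
  obtain ⟨N, hN, b₀, b₁, hb₀, hb₁⟩ := exists_integral_multiple h₀ h₁
  have hanti : ∀ I : Set (YL k), IsOrderIdeal I → sumOn b₁ I ≤ sumOn b₀ (idealInterior I) := by
    intro I hI
    have := mul_le_mul_of_nonneg_left (hideal I hI) hN.le
    rw [sumOn_natCast hb₀, sumOn_natCast hb₁] at this
    exact_mod_cast this
  have hB₂ : B.2 ≠ 0 := by
    intro h
    have hB₁ : total B.1 = 0 := by rw [htot, h]; simp [total]
    refine hne (Prod.ext (Finsupp.ext fun x => ?_) h)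
    by_contra hx
    exact hx ((Finset.sum_eq_zero_iff_of_nonneg fun y _ => h₀ y).1 hB₁ x
      (Finsupp.mem_support_iff.2 hx))
  have hb₁_ne : b₁ ≠ 0 := by
    rintro rfl
    refine hB₂ (Finsupp.ext fun x => ?_)
    have := hb₁ x
    simpa [hN.ne'] using this
  obtain ⟨lam, mu, hlt, hlam, hmu, hrem⟩ := exists_removable_pair hanti hb₁_ne
  have hge : ∀ {v : ℚ} {n : ℕ}, N * v = n → 0 < n → N⁻¹ ≤ v := by
    intro v n hv hn
    rw [inv_le_iff_one_le_mul₀' hN, hv]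
    exact_mod_cast hn
  refine ⟨lam, mu, hlt, N⁻¹, inv_pos.2 hN, ?_⟩
  rw [smul_pureTable]
  refine ⟨fun x => ?_, fun x => ?_, ?_, fun I hI => ?_⟩
  · simp only [Prod.fst_sub, Finsupp.sub_apply, Finsupp.single_apply, sub_nonneg]
    split_ifs with hx
    exacts [hx ▸ hge (hb₀ lam) hlam, h₀ x]
  · simp only [Prod.snd_sub, Finsupp.sub_apply, Finsupp.single_apply, sub_nonneg]
    split_ifs with hx
    exacts [hx ▸ hge (hb₁ mu) hmu, h₁ x]
  · simp only [← sumOn_univ] at htot ⊢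
    simp [sumOn_sub, sumOn_single, htot]
  · have := hrem I hI
    have hcast : ((sumOn b₁ I : ℕ) : ℚ) + (if lam ∈ idealInterior I then 1 else 0) ≤
        (sumOn b₀ (idealInterior I) : ℕ) + if mu ∈ I then 1 else 0 := by exact_mod_cast this
    rw [← sumOn_natCast hb₀, ← sumOn_natCast hb₁] at hcast
    simp only [Prod.fst_sub, Prod.snd_sub, sumOn_sub, sumOn_single]
    refine le_of_mul_le_mul_left ?_ hN
    simp only [mul_sub, mul_ite, mul_inv_cancel₀ hN.ne', mul_zero]
    linarith

end SumOn

/-- Every nonzero extremal table of the cone (one that admits only trivial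
decompositions as a sum of two cone elements) is a positive rational multiple of
a pure table `P(λ, μ)` for some comparable pair `λ < μ` in `Y±`. -/
theorem extremal_is_pure (k : ℕ) (hk : 0 < k) (B : Table k)
    (hB : InCone B) (hne : B ≠ 0)
    (hext : ∀ B₁ B₂ : Table k, InCone B₁ → InCone B₂ → B = B₁ + B₂ →
      (∃ c : ℚ, B₁ = c • B) ∧ (∃ c : ℚ, B₂ = c • B)) :
    ∃ lam mu : YL k, lam < mu ∧ ∃ q : ℚ, 0 < q ∧ B = q • pureTable lam mu := by
  obtain ⟨lam, mu, hlt, q, hq, hsub⟩ := exists_sub_pureTable_inCone hB hne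
  obtain ⟨⟨c, hc⟩, -⟩ := hext _ _ (inCone_smul_pureTable hq.le hlt) hsub
    (add_sub_cancel _ _).symm
  have hval : q = c * B.1 lam := by
    simpa [pureTable] using DFunLike.congr_fun (congrArg Prod.fst hc) lam
  have hcpos : 0 < c := pos_of_mul_pos_left (hval ▸ hq) (hB.1 lam)
  refine ⟨lam, mu, hlt, c⁻¹ * q, mul_pos (inv_pos.2 hcpos) hq, ?_⟩
  rw [mul_smul, hc, inv_smul_smul₀ hcpos.ne']
end
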